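/- For all c₁, c₂ > 0 there is C > 0 such that for all u, z : ℤ → [0,∞) with ‖u‖_{ℓ²}, ‖z‖_{ℓ²} < ∞: the sum of M₂ · u(j₁) u(j₂) u(j₃) u(k₂) u(k₃) z(k) over all integer tuples with k = k₁+k₂+k₃, k₁ = j₁+j₂+j₃, Φ(k̄) ≠ 0, |Φ(k̄)| ≥ c₁ (k*)² λ_k, and max(|k₂|,|k₃|) ≥ c₂ · min(|k|,|k₁|)^{1/100}, is at most C ‖u‖⁵_{ℓ²} ‖z‖_{ℓ²}, where M₂ := |k| ⟨k⟩^{1/2} ⟨k₁⟩ / (|Φ(k̄)| ⟨j₁⟩^{1/2} ⟨j₂⟩^{1/2} ⟨j₃⟩^{1/2} ⟨k₂⟩^{1/2} ⟨k₃⟩^{1/2}). -/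

import Mathlib

open scoped ENNReal

/-- Japanese bracket `⟨k⟩ = 1 + |k|`. -/
noncomputable def jb (k : ℤ) : ℝ := 1 + |(k : ℝ)|

/-- `‖u‖_{ℓ²} = (∑_k u(k)²)^{1/2}`, valued in `[0,∞]`. -/
noncomputable def l2 (u : ℤ → ℝ) : ℝ≥0∞ :=
  (∑' k : ℤ, ENNReal.ofReal (u k ^ 2)) ^ (1 / 2 : ℝ)

/-- `Φ(k̄) = k³ − k₁³ − k₂³ − k₃³` with `k = k₁ + k₂ + k₃`. -/
def Phi (k₁ k₂ k₃ : ℤ) : ℤ := (k₁ + k₂ + k₃) ^ 3 - k₁ ^ 3 - k₂ ^ 3 - k₃ ^ 3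

/-- The multiplier `M₂ = |k| ⟨k⟩^s ⟨k₁⟩ / (|Φ(k̄)| ⟨j₁⟩^s ⟨j₂⟩^s ⟨j₃⟩^s ⟨k₂⟩^s ⟨k₃⟩^s)`,
where `k₁ = j₁ + j₂ + j₃` and `k = k₁ + k₂ + k₃`. -/
noncomputable def M2 (s : ℝ) (j₁ j₂ j₃ k₂ k₃ : ℤ) : ℝ :=
  |((j₁ + j₂ + j₃ + k₂ + k₃ : ℤ) : ℝ)| * jb (j₁ + j₂ + j₃ + k₂ + k₃) ^ s *
    jb (j₁ + j₂ + j₃) /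
    (|((Phi (j₁ + j₂ + j₃) k₂ k₃ : ℤ) : ℝ)| *
      jb j₁ ^ s * jb j₂ ^ s * jb j₃ ^ s * jb k₂ ^ s * jb k₃ ^ s)

/-- `k* = max(|k₁|,|k₂|,|k₃|)`. -/
def kstar (k₁ k₂ k₃ : ℤ) : ℤ := max (max |k₁| |k₂|) |k₃|

/-- `λ_k = min(|k₁+k₂|,|k₂+k₃|,|k₃+k₁|)`. -/
def lam (k₁ k₂ k₃ : ℤ) : ℤ := min (min |k₁ + k₂| |k₂ + k₃|) |k₃ + k₁|

/-- `Λ_k = min(|k₁+k₂||k₂+k₃|, |k₂+k₃||k₃+k₁|, |k₃+k₁||k₁+k₂|)`. -/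
def Lam (k₁ k₂ k₃ : ℤ) : ℤ :=
  min (min (|k₁ + k₂| * |k₂ + k₃|) (|k₂ + k₃| * |k₃ + k₁|)) (|k₃ + k₁| * |k₁ + k₂|)

open Classical in
/-- Summand for the restricted `M₂` estimate: case (a), where `|Φ(k̄)| ≳ (k*)² λ_k` and
`max(|k₂|,|k₃|) ≳ min(|k|,|k₁|)^{1/100}`. -/
noncomputable def term15 (c₁ c₂ : ℝ) (u z : ℤ → ℝ) (j₁ j₂ j₃ k₂ k₃ : ℤ) : ℝ :=
  let k₁ := j₁ + j₂ + j₃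
  let k := k₁ + k₂ + k₃
  if Phi k₁ k₂ k₃ ≠ 0 ∧
      c₁ * ((kstar k₁ k₂ k₃ : ℤ) : ℝ) ^ 2 * ((lam k₁ k₂ k₃ : ℤ) : ℝ) ≤
        |((Phi k₁ k₂ k₃ : ℤ) : ℝ)| ∧
      c₂ * ((min |k| |k₁| : ℤ) : ℝ) ^ (1 / 100 : ℝ) ≤ ((max |k₂| |k₃| : ℤ) : ℝ) then
    M2 (1 / 2) j₁ j₂ j₃ k₂ k₃ * (u j₁ * u j₂ * u j₃ * u k₂ * u k₃ * z k)
  else 0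

section Weights

variable {δ : ℝ}

theorem inv_mul_le_of_max (hδ : 0 ≤ δ) (hδ' : δ ≤ 1 / 2) {a b c s : ℝ} (ha : 1 ≤ a) (hb : 1 ≤ b)
    (hc : 1 ≤ c) (hs : 1 ≤ s) (hba : b ≤ a) (hca : c ≤ a) (h : s ≤ a + b + c) :
    s ^ (1 - 2 * δ) / (a * b * c) ≤ 3 * (b ^ (-(1 + δ)) * c ^ (-(1 + δ))) := by
  have ha0 : 0 < a := by linarith
  have hb0 : 0 < b := by linarith
  have hc0 : 0 < c := by linarith
  have h1 : s ^ (1 - 2 * δ) ≤ 3 * a ^ (1 - 2 * δ) := by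
    calc s ^ (1 - 2 * δ) ≤ (3 * a) ^ (1 - 2 * δ) :=
          Real.rpow_le_rpow (by linarith) (by linarith) (by linarith)
      _ = 3 ^ (1 - 2 * δ) * a ^ (1 - 2 * δ) := Real.mul_rpow (by norm_num) ha0.le
      _ ≤ 3 ^ (1 : ℝ) * a ^ (1 - 2 * δ) := by
          gcongr
          · norm_num
          · linarith
      _ = _ := by rw [Real.rpow_one]
  have h2 : b ^ δ * c ^ δ ≤ a ^ (2 * δ) := by
    calc b ^ δ * c ^ δ ≤ a ^ δ * a ^ δ := by gcongr
      _ = a ^ (2 * δ) := by rw [← Real.rpow_add ha0]; ring_nf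
  have h3 : a ^ (1 - 2 * δ) * a ^ (2 * δ) = a := by
    rw [← Real.rpow_add ha0]; simp
  have e : ∀ x : ℝ, 0 < x → x ^ (-(1 + δ)) = (x * x ^ δ)⁻¹ := fun x hx => by
    rw [Real.rpow_neg hx.le, Real.rpow_add hx, Real.rpow_one]
  rw [e b hb0, e c hc0, ← mul_inv, ← div_eq_mul_inv, div_le_div_iff₀ (by positivity) (by positivity)]
  calc s ^ (1 - 2 * δ) * (b * b ^ δ * (c * c ^ δ))
      = b * c * (s ^ (1 - 2 * δ) * (b ^ δ * c ^ δ)) := by ring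
    _ ≤ b * c * (3 * a ^ (1 - 2 * δ) * a ^ (2 * δ)) := by gcongr
    _ = 3 * (a ^ (1 - 2 * δ) * a ^ (2 * δ) * b * c) := by ring
    _ = 3 * (a * b * c) := by rw [h3]

theorem inv_mul_le_sum (hδ : 0 ≤ δ) (hδ' : δ ≤ 1 / 2) {a b c s : ℝ} (ha : 1 ≤ a) (hb : 1 ≤ b)
    (hc : 1 ≤ c) (hs : 1 ≤ s) (h : s ≤ a + b + c) :
    s ^ (1 - 2 * δ) / (a * b * c) ≤ 3 * (b ^ (-(1 + δ)) * c ^ (-(1 + δ)) +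
      a ^ (-(1 + δ)) * c ^ (-(1 + δ)) + a ^ (-(1 + δ)) * b ^ (-(1 + δ))) := by
  have p1 : 0 ≤ b ^ (-(1 + δ)) * c ^ (-(1 + δ)) := by positivity
  have p2 : 0 ≤ a ^ (-(1 + δ)) * c ^ (-(1 + δ)) := by positivity
  have p3 : 0 ≤ a ^ (-(1 + δ)) * b ^ (-(1 + δ)) := by positivity
  by_cases h1 : b ≤ a ∧ c ≤ a
  · have := inv_mul_le_of_max hδ hδ' ha hb hc hs h1.1 h1.2 h
    linarith
  by_cases h2 : a ≤ b ∧ c ≤ b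
  · have := inv_mul_le_of_max hδ hδ' hb ha hc hs h2.1 h2.2 (by linarith)
    rw [mul_comm b a] at this
    linarith
  have h3 : a ≤ c ∧ b ≤ c := by grind
  have := inv_mul_le_of_max hδ hδ' hc ha hb hs h3.1 h3.2 (by linarith)
  rw [show c * a * b = a * b * c by ring] at this
  linarith

theorem cube_mul_rpow_le (hδ : 0 ≤ δ) (hδ' : δ ≤ 1 / 2) {N A T : ℝ} (hN : 1 ≤ N) (hA : 1 ≤ A)
    (hNT : N ≤ T) (hAT : A ≤ T) :
    N ^ 3 * A ^ (1 + 2 * δ) ≤ T ^ 4 * min N A ^ (2 * δ) := by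
  have hN0 : 0 < N := by linarith
  have hA0 : 0 < A := by linarith
  have hT0 : 0 < T := by linarith
  rw [Real.rpow_add hA0, Real.rpow_one]
  rcases le_total N A with h | h
  · rw [min_eq_left h]
    have h1 : N ^ 3 = N ^ (3 - 2 * δ) * N ^ (2 * δ) := by
      rw [← Real.rpow_add hN0, ← Real.rpow_natCast]; norm_num
    have h2 : T ^ 3 = T ^ (3 - 2 * δ) * T ^ (2 * δ) := by
      rw [← Real.rpow_add hT0, ← Real.rpow_natCast]; norm_num
    calc N ^ 3 * (A * A ^ (2 * δ)) = N ^ (3 - 2 * δ) * N ^ (2 * δ) * (A * A ^ (2 * δ)) := by rw [h1]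
      _ ≤ T ^ (3 - 2 * δ) * N ^ (2 * δ) * (T * T ^ (2 * δ)) := by
          gcongr
          linarith
      _ = (T ^ (3 - 2 * δ) * T ^ (2 * δ)) * T * N ^ (2 * δ) := by ring
      _ = T ^ 4 * N ^ (2 * δ) := by rw [← h2]; ring
  · rw [min_eq_right h]
    calc N ^ 3 * (A * A ^ (2 * δ)) ≤ T ^ 3 * (T * A ^ (2 * δ)) := by gcongr
      _ = _ := by ring

theorem div_le_of_le_rpow_quarter (hδ' : δ ≤ 1 / 2) {X D b c l : ℝ} (hD : 0 ≤ D)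
    (hb : 1 ≤ b) (hc : 1 ≤ c) (hl : 1 ≤ l) (hX : X ≤ D * (b * c) ^ (1 / 4 : ℝ)) :
    X / (l ^ 2 * b * c) ≤
      D * (l ^ (-(1 + δ)) * b ^ (-(1 + δ)) + l ^ (-(1 + δ)) * c ^ (-(1 + δ))) := by
  have hb0 : 0 < b := by linarith
  have hc0 : 0 < c := by linarith
  have hl0 : 0 < l := by linarith
  have key : (b * c) ^ (1 / 4 : ℝ) / (b * c) ≤ b ^ (-(1 + δ)) + c ^ (-(1 + δ)) := by
    have e : (b * c) ^ (1 / 4 : ℝ) / (b * c) = b ^ (-(3 / 4) : ℝ) * c ^ (-(3 / 4) : ℝ) := by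
      rw [← Real.mul_rpow hb0.le hc0.le, ← Real.rpow_sub_one (by positivity)]
      norm_num
    have aux : ∀ x y : ℝ, 1 ≤ x → x ≤ y →
        x ^ (-(3 / 4) : ℝ) * y ^ (-(3 / 4) : ℝ) ≤ x ^ (-(1 + δ)) := fun x y hx hxy => by
      calc x ^ (-(3 / 4) : ℝ) * y ^ (-(3 / 4) : ℝ) ≤ x ^ (-(3 / 4) : ℝ) * x ^ (-(3 / 4) : ℝ) :=
            mul_le_mul_of_nonneg_left
              (Real.rpow_le_rpow_of_nonpos (by linarith) hxy (by norm_num)) (by positivity)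
        _ = x ^ (-(3 / 2) : ℝ) := by rw [← Real.rpow_add (by linarith)]; norm_num
        _ ≤ x ^ (-(1 + δ)) := Real.rpow_le_rpow_of_exponent_le hx (by linarith)
    rw [e]
    rcases le_total b c with h | h
    · exact (aux b c hb h).trans (le_add_of_nonneg_right (by positivity))
    · rw [mul_comm]
      exact (aux c b hc h).trans (le_add_of_nonneg_left (by positivity))
  have hl2 : (l ^ 2)⁻¹ ≤ l ^ (-(1 + δ)) := by
    rw [← Real.rpow_natCast, ← Real.rpow_neg hl0.le]
    exact Real.rpow_le_rpow_of_exponent_le hl (by push_cast; linarith)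
  calc X / (l ^ 2 * b * c) ≤ D * (b * c) ^ (1 / 4 : ℝ) / (l ^ 2 * b * c) := by gcongr
    _ = D * ((l ^ 2)⁻¹ * ((b * c) ^ (1 / 4 : ℝ) / (b * c))) := by field_simp
    _ ≤ D * (l ^ (-(1 + δ)) * (b ^ (-(1 + δ)) + c ^ (-(1 + δ)))) := by gcongr
    _ = _ := by ring

theorem div_le_of_le_mul (hδ : 0 ≤ δ) (hδ' : δ ≤ 1 / 8) {N A T b c d : ℝ}
    (hN : 1 ≤ N) (hA : 1 ≤ A) (hb : 1 ≤ b) (hc : 1 ≤ c) (hd : 1 ≤ d)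
    (hNT : N ≤ T) (hAT : A ≤ T) (hbT : b ≤ T) (hNd : N ≤ d * c) :
    N ^ 3 * A ^ (1 + 2 * δ) / T ^ 4 / (d ^ 2 * b * c) ≤ d ^ (-(1 + δ)) * b ^ (-(1 + δ)) := by
  have hN0 : 0 < N := by linarith
  have hA0 : 0 < A := by linarith
  have hT0 : 0 < T := by linarith
  have hb0 : 0 < b := by linarith
  have hc0 : 0 < c := by linarith
  have hd0 : 0 < d := by linarith
  have e1 : N ^ 3 = N ^ (3 - 4 * δ) * N ^ (4 * δ) := by
    rw [← Real.rpow_add hN0, ← Real.rpow_natCast]; norm_num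
  have e2 : T ^ 4 = T ^ (3 - 4 * δ) * T ^ (1 + 2 * δ) * T ^ (2 * δ) := by
    rw [← Real.rpow_add hT0, ← Real.rpow_add hT0, ← Real.rpow_natCast]
    congr 1; push_cast; ring
  have h1 : N ^ 3 * A ^ (1 + 2 * δ) / T ^ 4 ≤ d ^ (4 * δ) * c ^ (4 * δ) / b ^ δ := by
    rw [div_le_div_iff₀ (by positivity) (by positivity), e1, e2]
    calc N ^ (3 - 4 * δ) * N ^ (4 * δ) * A ^ (1 + 2 * δ) * b ^ δ
        ≤ T ^ (3 - 4 * δ) * (d * c) ^ (4 * δ) * T ^ (1 + 2 * δ) * T ^ (2 * δ) := by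
          have : b ^ δ ≤ T ^ (2 * δ) :=
            (Real.rpow_le_rpow_of_exponent_le hb (by linarith)).trans
              (Real.rpow_le_rpow hb0.le hbT (by linarith))
          gcongr
          linarith
      _ = _ := by rw [Real.mul_rpow hd0.le hc0.le]; ring
  have hd2 : d ^ (4 * δ) / d ^ 2 ≤ d ^ (-(1 + δ)) := by
    rw [← Real.rpow_natCast, ← Real.rpow_sub hd0]
    exact Real.rpow_le_rpow_of_exponent_le hd (by push_cast; linarith)
  have hc2 : c ^ (4 * δ) / c ≤ 1 := by
    rw [div_le_one hc0]
    exact (Real.rpow_le_rpow_of_exponent_le hc (by linarith : 4 * δ ≤ 1)).trans_eq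
      (Real.rpow_one c)
  have hb2 : b ^ (-(1 + δ)) = (b * b ^ δ)⁻¹ := by
    rw [Real.rpow_neg hb0.le, Real.rpow_add hb0, Real.rpow_one]
  calc N ^ 3 * A ^ (1 + 2 * δ) / T ^ 4 / (d ^ 2 * b * c)
      ≤ d ^ (4 * δ) * c ^ (4 * δ) / b ^ δ / (d ^ 2 * b * c) := by gcongr
    _ = d ^ (4 * δ) / d ^ 2 * (c ^ (4 * δ) / c) * (b * b ^ δ)⁻¹ := by field_simp
    _ ≤ d ^ (-(1 + δ)) * 1 * (b * b ^ δ)⁻¹ := by gcongr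
    _ = _ := by rw [hb2, mul_one]

end Weights

theorem one_le_jb (k : ℤ) : 1 ≤ jb k := by
  unfold jb; linarith [abs_nonneg (k : ℝ)]

theorem jb_le_two_mul {k : ℤ} (hk : k ≠ 0) : jb k ≤ 2 * |(k : ℝ)| := by
  have : (1 : ℝ) ≤ |(k : ℝ)| := by exact_mod_cast Int.one_le_abs hk
  unfold jb; linarith

theorem jb_add_le (m n : ℤ) : jb (m + n) ≤ jb m * jb n := by
  unfold jb
  push_cast
  nlinarith [abs_add_le (m : ℝ) n, abs_nonneg (m : ℝ), abs_nonneg (n : ℝ)]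

theorem Phi_eq (k₁ k₂ k₃ : ℤ) : Phi k₁ k₂ k₃ = 3 * (k₁ + k₂) * (k₂ + k₃) * (k₃ + k₁) := by
  unfold Phi; ring

theorem pair_sums_ne_zero {k₁ k₂ k₃ : ℤ} (h : Phi k₁ k₂ k₃ ≠ 0) :
    k₁ + k₂ ≠ 0 ∧ k₂ + k₃ ≠ 0 ∧ k₃ + k₁ ≠ 0 := by
  rw [Phi_eq] at h
  refine ⟨?_, ?_, ?_⟩ <;> rintro h0 <;> simp [h0] at h

theorem kstar_pos {k₁ k₂ k₃ : ℤ} (h : Phi k₁ k₂ k₃ ≠ 0) : 0 < kstar k₁ k₂ k₃ := by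
  have := (pair_sums_ne_zero h).1
  unfold kstar
  grind

theorem lam_pos {k₁ k₂ k₃ : ℤ} (h : Phi k₁ k₂ k₃ ≠ 0) : 0 < lam k₁ k₂ k₃ := by
  obtain ⟨h12, h23, h31⟩ := pair_sums_ne_zero h
  exact lt_min (lt_min (abs_pos.2 h12) (abs_pos.2 h23)) (abs_pos.2 h31)

/-- The threshold condition lets a small power of `min ⟨k⟩ ⟨k₁⟩` be absorbed by `⟨k₂⟩⟨k₃⟩`. -/
theorem min_jb_rpow_le {c₂ : ℝ} (hc₂ : 0 < c₂) {k k₁ k₂ k₃ : ℤ}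
    (h : c₂ * ((min |k| |k₁| : ℤ) : ℝ) ^ (1 / 100 : ℝ) ≤ ((max |k₂| |k₃| : ℤ) : ℝ)) :
    min (jb k) (jb k₁) ^ (2 * (1 / 800) : ℝ) ≤
      (1 + 1 / c₂) ^ (1 / 4 : ℝ) * (jb k₂ * jb k₃) ^ (1 / 4 : ℝ) := by
  have h2 := one_le_jb k₂
  have h3 := one_le_jb k₃
  set m : ℝ := ((min |k| |k₁| : ℤ) : ℝ) with hm
  have hm0 : 0 ≤ m := by rw [hm]; exact_mod_cast le_min (abs_nonneg k) (abs_nonneg k₁)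
  have e : min (jb k) (jb k₁) = 1 + m := by
    rw [hm]; push_cast; unfold jb; exact min_add_add_left _ _ _
  have hmax : ((max |k₂| |k₃| : ℤ) : ℝ) ≤ jb k₂ * jb k₃ := by
    push_cast
    refine max_le ?_ ?_
    · calc |(k₂ : ℝ)| ≤ jb k₂ := by unfold jb; linarith
        _ ≤ _ := le_mul_of_one_le_right (by linarith) h3
    · calc |(k₃ : ℝ)| ≤ jb k₃ := by unfold jb; linarith
        _ ≤ _ := le_mul_of_one_le_left (by linarith) h2
  have h4 : (1 + m) ^ (1 / 100 : ℝ) ≤ (1 + 1 / c₂) * (jb k₂ * jb k₃) := by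
    calc (1 + m) ^ (1 / 100 : ℝ) ≤ 1 ^ (1 / 100 : ℝ) + m ^ (1 / 100 : ℝ) :=
          Real.rpow_add_le_add_rpow (by norm_num) hm0 (by norm_num) (by norm_num)
      _ ≤ jb k₂ * jb k₃ + jb k₂ * jb k₃ / c₂ := by
          rw [Real.one_rpow]
          gcongr
          · nlinarith
          · rw [le_div_iff₀ hc₂]; linarith
      _ = _ := by ring
  rw [e, ← Real.mul_rpow (by positivity) (by positivity)]
  calc (1 + m) ^ (2 * (1 / 800) : ℝ) = ((1 + m) ^ (1 / 100 : ℝ)) ^ (1 / 4 : ℝ) := by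
        rw [← Real.rpow_mul (by positivity)]; norm_num
    _ ≤ _ := Real.rpow_le_rpow (by positivity) h4 (by norm_num)

/-- The summable weight `⟨k⟩^{-(1+1/800)}`. -/
noncomputable def jbw (k : ℤ) : ℝ := jb k ^ (-(1 + 1 / 800) : ℝ)

theorem jbw_nonneg (k : ℤ) : 0 ≤ jbw k :=
  Real.rpow_nonneg (zero_le_one.trans (one_le_jb k)) _

theorem outer_weight_le {c₂ : ℝ} (hc₂ : 0 < c₂) {k₁ k₂ k₃ : ℤ} (hΦ : Phi k₁ k₂ k₃ ≠ 0)
    (h : c₂ * ((min |k₁ + k₂ + k₃| |k₁| : ℤ) : ℝ) ^ (1 / 100 : ℝ) ≤ ((max |k₂| |k₃| : ℤ) : ℝ)) :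
    jb (k₁ + k₂ + k₃) ^ 3 * jb k₁ ^ (1 + 2 * (1 / 800) : ℝ) /
      (((kstar k₁ k₂ k₃ : ℤ) : ℝ) ^ 4 * ((lam k₁ k₂ k₃ : ℤ) : ℝ) ^ 2 * jb k₂ * jb k₃) ≤
    1024 * (1 + (1 + 1 / c₂) ^ (1 / 4 : ℝ)) *
      (jbw (k₂ + k₃) * jbw k₂ + jbw (k₂ + k₃) * jbw k₃ + jbw (k₁ + k₂) * jbw k₂ +
        jbw (k₃ + k₁) * jbw k₃) := by
  obtain ⟨n12, n23, n31⟩ := pair_sums_ne_zero hΦ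
  have hk1 : 1 ≤ kstar k₁ k₂ k₃ := kstar_pos hΦ
  have b1 : |k₁| ≤ kstar k₁ k₂ k₃ := by unfold kstar; omega
  have b2 : |k₂| ≤ kstar k₁ k₂ k₃ := by unfold kstar; omega
  have b3 : |k₃| ≤ kstar k₁ k₂ k₃ := by unfold kstar; omega
  have b0 : |k₁ + k₂ + k₃| ≤ 3 * kstar k₁ k₂ k₃ := by
    linarith [abs_add_three k₁ k₂ k₃]
  set K : ℝ := ((kstar k₁ k₂ k₃ : ℤ) : ℝ) with hK
  have hk1' : (1 : ℝ) ≤ K := by rw [hK]; exact_mod_cast hk1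
  have tb : ∀ n : ℤ, |n| ≤ 3 * kstar k₁ k₂ k₃ → jb n ≤ 4 * K := fun n hn => by
    have : |(n : ℝ)| ≤ 3 * K := by rw [hK]; exact_mod_cast hn
    unfold jb; linarith
  have t0 := tb _ b0
  have t1 := tb k₁ (by omega)
  have t2 := tb k₂ (by omega)
  have t3 := tb k₃ (by omega)
  have o0 := one_le_jb (k₁ + k₂ + k₃)
  have o1 := one_le_jb k₁
  have o2 := one_le_jb k₂
  have o3 := one_le_jb k₃
  have o12 := one_le_jb (k₁ + k₂)
  have o23 := one_le_jb (k₂ + k₃)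
  have o31 := one_le_jb (k₃ + k₁)
  set E : ℝ := (1 + 1 / c₂) ^ (1 / 4 : ℝ) with hE
  have hE0 : 0 ≤ E := by positivity
  have q1 : 0 ≤ jbw (k₂ + k₃) * jbw k₂ := mul_nonneg (jbw_nonneg _) (jbw_nonneg _)
  have q2 : 0 ≤ jbw (k₂ + k₃) * jbw k₃ := mul_nonneg (jbw_nonneg _) (jbw_nonneg _)
  have q3 : 0 ≤ jbw (k₁ + k₂) * jbw k₂ := mul_nonneg (jbw_nonneg _) (jbw_nonneg _)
  have q4 : 0 ≤ jbw (k₃ + k₁) * jbw k₃ := mul_nonneg (jbw_nonneg _) (jbw_nonneg _)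
  set X : ℝ := jb (k₁ + k₂ + k₃) ^ 3 * jb k₁ ^ (1 + 2 * (1 / 800) : ℝ) with hX
  have hX0 : 0 ≤ X := by positivity
  -- passing from `K⁴ λ²` to `(4K)⁴ ⟨l⟩²`
  have scale : ∀ l : ℤ, l ≠ 0 → lam k₁ k₂ k₃ = |l| →
      X / (K ^ 4 * ((lam k₁ k₂ k₃ : ℤ) : ℝ) ^ 2 * jb k₂ * jb k₃) ≤
        1024 * (X / (4 * K) ^ 4 / (jb l ^ 2 * jb k₂ * jb k₃)) := fun l hl hlam => by
    have hjl := jb_le_two_mul hl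
    have hl1 : (1 : ℝ) ≤ |(l : ℝ)| := by exact_mod_cast Int.one_le_abs hl
    have hjl1 := one_le_jb l
    rw [hlam]
    push_cast
    rw [div_div, ← mul_div_assoc, div_le_div_iff₀ (by positivity) (by positivity)]
    calc X * ((4 * K) ^ 4 * (jb l ^ 2 * jb k₂ * jb k₃))
        ≤ X * ((4 * K) ^ 4 * ((2 * |(l : ℝ)|) ^ 2 * jb k₂ * jb k₃)) := by gcongr
      _ = _ := by ring
  have hcases : lam k₁ k₂ k₃ = |k₂ + k₃| ∨ lam k₁ k₂ k₃ = |k₁ + k₂| ∨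
      lam k₁ k₂ k₃ = |k₃ + k₁| := by unfold lam; omega
  rcases hcases with hl | hl | hl
  · have hXle : X / (4 * K) ^ 4 ≤ E * (jb k₂ * jb k₃) ^ (1 / 4 : ℝ) := by
      rw [div_le_iff₀ (by positivity)]
      calc X ≤ (4 * K) ^ 4 * min (jb (k₁ + k₂ + k₃)) (jb k₁) ^ (2 * (1 / 800) : ℝ) :=
            cube_mul_rpow_le (by norm_num) (by norm_num) o0 o1 t0 t1
        _ ≤ (4 * K) ^ 4 * (E * (jb k₂ * jb k₃) ^ (1 / 4 : ℝ)) := by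
            gcongr; exact min_jb_rpow_le hc₂ h
        _ = _ := by ring
    have key := div_le_of_le_rpow_quarter (δ := 1 / 800) (by norm_num) hE0 o2 o3 o23
      hXle
    refine (scale _ n23 hl).trans ?_
    change _ ≤ E * (jbw (k₂ + k₃) * jbw k₂ + jbw (k₂ + k₃) * jbw k₃) at key
    nlinarith [mul_nonneg hE0 q3, mul_nonneg hE0 q4]
  · have hN : jb (k₁ + k₂ + k₃) ≤ jb (k₁ + k₂) * jb k₃ := jb_add_le _ _
    have key := div_le_of_le_mul (δ := 1 / 800) (by norm_num) (by norm_num) o0 o1 o2 o3 o12 t0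
      t1 t2 hN
    refine (scale _ n12 hl).trans ?_
    rw [← hX] at key
    change _ ≤ jbw (k₁ + k₂) * jbw k₂ at key
    nlinarith [mul_nonneg hE0 q1, mul_nonneg hE0 q2, mul_nonneg hE0 q3, mul_nonneg hE0 q4]
  · have hN : jb (k₁ + k₂ + k₃) ≤ jb (k₃ + k₁) * jb k₂ := by
      rw [show k₁ + k₂ + k₃ = (k₃ + k₁) + k₂ by ring]; exact jb_add_le _ _
    have key := div_le_of_le_mul (δ := 1 / 800) (by norm_num) (by norm_num) o0 o1 o3 o2 o31 t0
      t1 t3 hN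
    refine (scale _ n31 hl).trans ?_
    rw [show jb (k₃ + k₁) ^ 2 * jb k₂ * jb k₃ = jb (k₃ + k₁) ^ 2 * jb k₃ * jb k₂ by ring]
    rw [← hX] at key
    change _ ≤ jbw (k₃ + k₁) * jbw k₃ at key
    nlinarith [mul_nonneg hE0 q1, mul_nonneg hE0 q2, mul_nonneg hE0 q3, mul_nonneg hE0 q4]

theorem inner_weight_le (j₁ j₂ j₃ : ℤ) :
    jb (j₁ + j₂ + j₃) ^ (1 - 2 * (1 / 800) : ℝ) / (jb j₁ * jb j₂ * jb j₃) ≤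
      3 * (jbw j₂ * jbw j₃ + jbw j₁ * jbw j₃ + jbw j₁ * jbw j₂) := by
  refine inv_mul_le_sum (δ := 1 / 800) (by norm_num) (by norm_num) (one_le_jb _) (one_le_jb _)
    (one_le_jb _) (one_le_jb _) ?_
  unfold jb
  push_cast
  linarith [abs_add_three (j₁ : ℝ) j₂ j₃]

/-- Pointwise bound of the squared multiplier by products of four summable weights. -/
theorem M2_sq_le {c₁ c₂ : ℝ} (hc₁ : 0 < c₁) (hc₂ : 0 < c₂) {j₁ j₂ j₃ k₁ k₂ k₃ : ℤ}
    (hk₁ : k₁ = j₁ + j₂ + j₃) (hΦ : Phi k₁ k₂ k₃ ≠ 0)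
    (hΦ' : c₁ * ((kstar k₁ k₂ k₃ : ℤ) : ℝ) ^ 2 * ((lam k₁ k₂ k₃ : ℤ) : ℝ) ≤
        |((Phi k₁ k₂ k₃ : ℤ) : ℝ)|)
    (h : c₂ * ((min |k₁ + k₂ + k₃| |k₁| : ℤ) : ℝ) ^ (1 / 100 : ℝ) ≤ ((max |k₂| |k₃| : ℤ) : ℝ)) :
    M2 (1 / 2) j₁ j₂ j₃ k₂ k₃ ^ 2 ≤
      (3 * (1024 * (1 + (1 + 1 / c₂) ^ (1 / 4 : ℝ))) / c₁ ^ 2) *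
      ((jbw j₂ * jbw j₃ + jbw j₁ * jbw j₃ + jbw j₁ * jbw j₂) *
      (jbw (k₂ + k₃) * jbw k₂ + jbw (k₂ + k₃) * jbw k₃ + jbw (k₁ + k₂) * jbw k₂ +
        jbw (k₃ + k₁) * jbw k₃)) := by
  have ho := outer_weight_le hc₂ hΦ h
  have hi := inner_weight_le j₁ j₂ j₃
  rw [← hk₁] at hi
  have pos : ∀ n : ℤ, 0 < jb n := fun n => zero_lt_one.trans_le (one_le_jb n)
  have hK : (0 : ℝ) < ((kstar k₁ k₂ k₃ : ℤ) : ℝ) := Int.cast_pos.2 (kstar_pos hΦ)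
  have hL : (0 : ℝ) < ((lam k₁ k₂ k₃ : ℤ) : ℝ) := Int.cast_pos.2 (lam_pos hΦ)
  have sq : ∀ n : ℤ, (jb n ^ (1 / 2 : ℝ)) ^ 2 = jb n := fun n => by
    rw [← Real.sqrt_eq_rpow, Real.sq_sqrt (pos n).le]
  have hk : |((k₁ + k₂ + k₃ : ℤ) : ℝ)| ≤ jb (k₁ + k₂ + k₃) := by unfold jb; linarith
  have hp := pos (k₁ + k₂ + k₃)
  have hp1 := pos k₁
  have hp2 := pos k₂
  have hp3 := pos k₃
  have hq1 := pos j₁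
  have hq2 := pos j₂
  have hq3 := pos j₃
  have hA : jb k₁ ^ 2 = jb k₁ ^ (1 + 2 * (1 / 800) : ℝ) * jb k₁ ^ (1 - 2 * (1 / 800) : ℝ) := by
    rw [← Real.rpow_add hp1, ← Real.rpow_natCast]; norm_num
  set P : ℝ := |((Phi k₁ k₂ k₃ : ℤ) : ℝ)|
  set K : ℝ := ((kstar k₁ k₂ k₃ : ℤ) : ℝ)
  set L : ℝ := ((lam k₁ k₂ k₃ : ℤ) : ℝ)
  calc M2 (1 / 2) j₁ j₂ j₃ k₂ k₃ ^ 2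
      = |((k₁ + k₂ + k₃ : ℤ) : ℝ)| ^ 2 * jb (k₁ + k₂ + k₃) * jb k₁ ^ 2 /
          (P ^ 2 * jb j₁ * jb j₂ * jb j₃ * jb k₂ * jb k₃) := by
        unfold M2
        rw [← hk₁, div_pow]
        simp only [mul_pow, sq]
        rfl
    _ ≤ jb (k₁ + k₂ + k₃) ^ 2 * jb (k₁ + k₂ + k₃) * jb k₁ ^ 2 /
          ((c₁ * K ^ 2 * L) ^ 2 * jb j₁ * jb j₂ * jb j₃ * jb k₂ * jb k₃) := by
        gcongr
    _ = 1 / c₁ ^ 2 * ((jb k₁ ^ (1 - 2 * (1 / 800) : ℝ) / (jb j₁ * jb j₂ * jb j₃)) *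
          (jb (k₁ + k₂ + k₃) ^ 3 * jb k₁ ^ (1 + 2 * (1 / 800) : ℝ) /
            (K ^ 4 * L ^ 2 * jb k₂ * jb k₃))) := by
        rw [hA]; field_simp
    _ ≤ 1 / c₁ ^ 2 * ((3 * (jbw j₂ * jbw j₃ + jbw j₁ * jbw j₃ + jbw j₁ * jbw j₂)) *
          (1024 * (1 + (1 + 1 / c₂) ^ (1 / 4 : ℝ)) *
      (jbw (k₂ + k₃) * jbw k₂ + jbw (k₂ + k₃) * jbw k₃ + jbw (k₁ + k₂) * jbw k₂ +
        jbw (k₃ + k₁) * jbw k₃))) := by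
        have := jbw_nonneg
        have h0 : 0 ≤ 3 * (jbw j₂ * jbw j₃ + jbw j₁ * jbw j₃ + jbw j₁ * jbw j₂) := by
          have := mul_nonneg (this j₂) (this j₃)
          have := mul_nonneg (jbw_nonneg j₁) (jbw_nonneg j₃)
          have := mul_nonneg (jbw_nonneg j₁) (jbw_nonneg j₂)
          linarith
        refine mul_le_mul_of_nonneg_left (mul_le_mul hi ho (by positivity) h0) (by positivity)
    _ = _ := by ring

theorem tsum_jbw_ne_top : ∑' k : ℤ, ENNReal.ofReal (jbw k) ≠ ⊤ := by
  have hs : Summable jbw := by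
    have h : Summable fun n : ℕ => ((n + 1 : ℕ) : ℝ) ^ (-(1 + 1 / 800) : ℝ) :=
      (summable_nat_add_iff 1).2 (Real.summable_nat_rpow.2 (by norm_num))
    refine Summable.of_nat_of_neg (h.congr fun n => ?_) (h.congr fun n => ?_) <;>
      simp [jbw, jb, add_comm]
  exact hs.tsum_ofReal_ne_top

theorem tsum_mul_le_sqrt {ι : Type*} (f g : ι → ℝ≥0∞) :
    ∑' i, f i * g i ≤ (∑' i, f i ^ 2) ^ (1 / 2 : ℝ) * (∑' i, g i ^ 2) ^ (1 / 2 : ℝ) := by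
  rw [ENNReal.tsum_eq_iSup_sum]
  refine iSup_le fun s => ?_
  refine (ENNReal.inner_le_Lp_mul_Lq s f g Real.HolderConjugate.two_two).trans ?_
  simp only [ENNReal.rpow_two]
  gcongr <;> exact ENNReal.sum_le_tsum s

theorem tsum_prod_five (f₀ f₁ f₂ f₃ f₄ : ℤ → ℝ≥0∞) :
    ∑' q : ℤ × ℤ × ℤ × ℤ × ℤ,
      f₀ q.1 * (f₁ q.2.1 * (f₂ q.2.2.1 * (f₃ q.2.2.2.1 * f₄ q.2.2.2.2))) =
    (∑' n, f₀ n) * ((∑' n, f₁ n) * ((∑' n, f₂ n) * ((∑' n, f₃ n) * ∑' n, f₄ n))) := by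
  have two : ∀ {β : Type} (f : ℤ → ℝ≥0∞) (g : β → ℝ≥0∞),
      ∑' p : ℤ × β, f p.1 * g p.2 = (∑' n, f n) * ∑' b, g b := fun f g => by
    rw [ENNReal.tsum_prod (f := fun a b => f a * g b)]
    simp only [ENNReal.tsum_mul_left, ENNReal.tsum_mul_right]
  rw [two f₀ fun r : ℤ × ℤ × ℤ × ℤ =>
      f₁ r.1 * (f₂ r.2.1 * (f₃ r.2.2.1 * f₄ r.2.2.2)),
    two f₁ fun r : ℤ × ℤ × ℤ => f₂ r.1 * (f₃ r.2.1 * f₄ r.2.2),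
    two f₂ fun r : ℤ × ℤ => f₃ r.1 * f₄ r.2, two f₃ f₄]

theorem tsum_weights_comp_le (f g : ℤ → ℝ≥0∞)
    (L : ℤ × ℤ × ℤ × ℤ × ℤ → ℤ × ℤ × ℤ × ℤ × ℤ) (hL : Function.Injective L) :
    ∑' q, f (L q).1 * (g (L q).2.1 * (g (L q).2.2.1 * (g (L q).2.2.2.1 * g (L q).2.2.2.2))) ≤
      (∑' n, f n) * (∑' n, g n) ^ 4 := by
  refine (ENNReal.tsum_comp_le_tsum_of_injective hL fun q =>
    f q.1 * (g q.2.1 * (g q.2.2.1 * (g q.2.2.2.1 * g q.2.2.2.2)))).trans ?_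
  rw [tsum_prod_five]
  exact le_of_eq (by ring)

theorem tsum_weights_le (f g : ℤ → ℝ≥0∞) :
    ∑' q : ℤ × ℤ × ℤ × ℤ × ℤ, f (q.1 + q.2.1 + q.2.2.1 + q.2.2.2.1 + q.2.2.2.2) *
      ((g q.2.1 * g q.2.2.1 + g q.1 * g q.2.2.1 + g q.1 * g q.2.1) *
      (g (q.2.2.2.1 + q.2.2.2.2) * g q.2.2.2.1 + g (q.2.2.2.1 + q.2.2.2.2) * g q.2.2.2.2 +
        g (q.1 + q.2.1 + q.2.2.1 + q.2.2.2.1) * g q.2.2.2.1 +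
        g (q.2.2.2.2 + (q.1 + q.2.1 + q.2.2.1)) * g q.2.2.2.2)) ≤
      12 * ((∑' n, f n) * (∑' n, g n) ^ 4) := by
  have key : ∀ a b c d : ℤ × ℤ × ℤ × ℤ × ℤ → ℤ,
      Function.Injective (fun q : ℤ × ℤ × ℤ × ℤ × ℤ =>
        (q.1 + q.2.1 + q.2.2.1 + q.2.2.2.1 + q.2.2.2.2, a q, b q, c q, d q)) →
      ∑' q : ℤ × ℤ × ℤ × ℤ × ℤ, f (q.1 + q.2.1 + q.2.2.1 + q.2.2.2.1 + q.2.2.2.2) *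
        (g (a q) * (g (b q) * (g (c q) * g (d q)))) ≤ (∑' n, f n) * (∑' n, g n) ^ 4 :=
    fun a b c d h => tsum_weights_comp_le f g _ h
  simp only [mul_add, add_mul, ENNReal.tsum_add, mul_assoc]
  rw [show (12 : ℝ≥0∞) = 1 + 1 + 1 + (1 + 1 + 1) + (1 + 1 + 1) + (1 + 1 + 1) by norm_num]
  simp only [add_mul, one_mul]
  repeat' apply add_le_add
  all_goals
    refine key (fun q => _) (fun q => _) (fun q => _) (fun q => _) ?_
    rintro ⟨a, b, c, d, e⟩ ⟨a', b', c', d', e'⟩ h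
    simp only [Prod.mk.injEq] at h ⊢
    omega

/-- Restricted quintic `M₂` estimate at `s = 1/2`, case (a). -/
theorem M2_restricted_a (c₁ c₂ : ℝ) (hc₁ : 0 < c₁) (hc₂ : 0 < c₂) :
    ∃ C > (0 : ℝ), ∀ u z : ℤ → ℝ, (∀ k, 0 ≤ u k) → (∀ k, 0 ≤ z k) →
      l2 u < ⊤ → l2 z < ⊤ →
      (∑' q : ℤ × ℤ × ℤ × ℤ × ℤ,
        ENNReal.ofReal (term15 c₁ c₂ u z q.1 q.2.1 q.2.2.1 q.2.2.2.1 q.2.2.2.2)) ≤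
        ENNReal.ofReal C * l2 u ^ 5 * l2 z := by
  set C₀ : ℝ := 3 * (1024 * (1 + (1 + 1 / c₂) ^ (1 / 4 : ℝ))) / c₁ ^ 2 with hC₀
  have hC₀pos : 0 < C₀ := by positivity
  set g : ℤ → ℝ≥0∞ := fun n => ENNReal.ofReal (jbw n) with hg
  set B : ℝ≥0∞ := (ENNReal.ofReal C₀ * (12 * (∑' n, g n) ^ 4)) ^ (1 / 2 : ℝ) with hB
  have hBtop : B ≠ ⊤ := by
    refine ENNReal.rpow_ne_top_of_nonneg (by norm_num) ?_
    exact ENNReal.mul_ne_top ENNReal.ofReal_ne_top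
      (ENNReal.mul_ne_top (by norm_num) (ENNReal.pow_ne_top tsum_jbw_ne_top))
  refine ⟨B.toReal + 1, by positivity, fun u z hu hz _ _ => ?_⟩
  set F : ℤ × ℤ × ℤ × ℤ × ℤ → ℝ≥0∞ := fun q =>
    ENNReal.ofReal (u q.1 * (u q.2.1 * (u q.2.2.1 * (u q.2.2.2.1 * u q.2.2.2.2)))) with hF
  set W : ℤ × ℤ × ℤ × ℤ × ℤ → ℝ≥0∞ := fun q =>
    ENNReal.ofReal (term15 c₁ c₂ (fun _ => 1) z q.1 q.2.1 q.2.2.1 q.2.2.2.1 q.2.2.2.2) with hW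
  have hterm : ∀ q : ℤ × ℤ × ℤ × ℤ × ℤ,
      ENNReal.ofReal (term15 c₁ c₂ u z q.1 q.2.1 q.2.2.1 q.2.2.2.1 q.2.2.2.2) = F q * W q := by
    intro q
    have h5 : 0 ≤ u q.1 * (u q.2.1 * (u q.2.2.1 * (u q.2.2.2.1 * u q.2.2.2.2))) :=
      mul_nonneg (hu _) (mul_nonneg (hu _) (mul_nonneg (hu _) (mul_nonneg (hu _) (hu _))))
    rw [hF, hW, ← ENNReal.ofReal_mul h5]
    congr 1
    unfold term15
    dsimp only
    split_ifs
    · ring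
    · simp
  have hFsum : ∑' q, F q ^ 2 = (∑' n, ENNReal.ofReal (u n ^ 2)) ^ 5 := by
    have : ∀ q : ℤ × ℤ × ℤ × ℤ × ℤ, F q ^ 2 =
        ENNReal.ofReal (u q.1 ^ 2) * (ENNReal.ofReal (u q.2.1 ^ 2) *
          (ENNReal.ofReal (u q.2.2.1 ^ 2) * (ENNReal.ofReal (u q.2.2.2.1 ^ 2) *
            ENNReal.ofReal (u q.2.2.2.2 ^ 2)))) := fun q => by
      simp only [hF, ENNReal.ofReal_mul (hu _), ENNReal.ofReal_pow (hu _), mul_pow]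
    simp only [this]
    rw [tsum_prod_five (fun n => ENNReal.ofReal (u n ^ 2)) (fun n => ENNReal.ofReal (u n ^ 2))
      (fun n => ENNReal.ofReal (u n ^ 2)) (fun n => ENNReal.ofReal (u n ^ 2))
      (fun n => ENNReal.ofReal (u n ^ 2))]
    ring
  have hWle : ∀ q : ℤ × ℤ × ℤ × ℤ × ℤ, W q ^ 2 ≤ ENNReal.ofReal C₀ *
      (ENNReal.ofReal (z (q.1 + q.2.1 + q.2.2.1 + q.2.2.2.1 + q.2.2.2.2) ^ 2) *
      ((g q.2.1 * g q.2.2.1 + g q.1 * g q.2.2.1 + g q.1 * g q.2.1) *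
      (g (q.2.2.2.1 + q.2.2.2.2) * g q.2.2.2.1 + g (q.2.2.2.1 + q.2.2.2.2) * g q.2.2.2.2 +
        g (q.1 + q.2.1 + q.2.2.1 + q.2.2.2.1) * g q.2.2.2.1 +
        g (q.2.2.2.2 + (q.1 + q.2.1 + q.2.2.1)) * g q.2.2.2.2))) := by
    rintro ⟨j₁, j₂, j₃, k₂, k₃⟩
    simp only [hW, term15]
    split_ifs with h
    · have hM := M2_sq_le hc₁ hc₂ rfl h.1 h.2.1 h.2.2
      have hM0 : 0 ≤ M2 (1 / 2) j₁ j₂ j₃ k₂ k₃ := by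
        have pos : ∀ n : ℤ, 0 < jb n := fun n => zero_lt_one.trans_le (one_le_jb n)
        have := pos (j₁ + j₂ + j₃ + k₂ + k₃)
        have := pos (j₁ + j₂ + j₃)
        have := pos j₁
        have := pos j₂
        have := pos j₃
        have := pos k₂
        have := pos k₃
        unfold M2
        positivity
      have hp : ∀ m n : ℤ, 0 ≤ jbw m * jbw n := fun m n =>
        mul_nonneg (jbw_nonneg _) (jbw_nonneg _)
      have hpe : ∀ m n : ℤ, g m * g n = ENNReal.ofReal (jbw m * jbw n) := fun m n =>
        (ENNReal.ofReal_mul (jbw_nonneg _)).symm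
      simp only [hpe]
      rw [← ENNReal.ofReal_pow (by simpa using mul_nonneg hM0 (hz _)),
        ← ENNReal.ofReal_add (hp _ _) (hp _ _),
        ← ENNReal.ofReal_add (by linarith [hp j₂ j₃, hp j₁ j₃]) (hp _ _),
        ← ENNReal.ofReal_add (hp _ _) (hp _ _),
        ← ENNReal.ofReal_add (add_nonneg (hp _ _) (hp _ _)) (hp _ _),
        ← ENNReal.ofReal_add (add_nonneg (add_nonneg (hp _ _) (hp _ _)) (hp _ _)) (hp _ _),
        ← ENNReal.ofReal_mul (add_nonneg (add_nonneg (hp _ _) (hp _ _)) (hp _ _)),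
        ← ENNReal.ofReal_mul (sq_nonneg _), ← ENNReal.ofReal_mul hC₀pos.le]
      refine ENNReal.ofReal_le_ofReal ?_
      simp only [one_mul, mul_pow]
      refine (mul_le_mul_of_nonneg_right hM (sq_nonneg _)).trans_eq ?_
      ring
    · simp
  have hWsum : ∑' q, W q ^ 2 ≤
      (ENNReal.ofReal C₀ * (12 * (∑' n, g n) ^ 4)) * ∑' n, ENNReal.ofReal (z n ^ 2) := by
    refine (ENNReal.tsum_le_tsum hWle).trans ?_
    rw [ENNReal.tsum_mul_left]
    refine (mul_le_mul_right (tsum_weights_le (fun n => ENNReal.ofReal (z n ^ 2)) g) _).trans_eq ?_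
    ring
  simp only [hterm]
  calc ∑' q, F q * W q ≤ (∑' q, F q ^ 2) ^ (1 / 2 : ℝ) * (∑' q, W q ^ 2) ^ (1 / 2 : ℝ) :=
        tsum_mul_le_sqrt F W
    _ ≤ ((∑' n, ENNReal.ofReal (u n ^ 2)) ^ 5) ^ (1 / 2 : ℝ) *
        ((ENNReal.ofReal C₀ * (12 * (∑' n, g n) ^ 4)) *
          ∑' n, ENNReal.ofReal (z n ^ 2)) ^ (1 / 2 : ℝ) := by
        rw [hFsum]; gcongr
    _ = B * l2 u ^ 5 * l2 z := by
        rw [ENNReal.mul_rpow_of_nonneg _ _ (by norm_num : (0 : ℝ) ≤ 1 / 2)]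
        unfold l2
        rw [← ENNReal.rpow_natCast, ← ENNReal.rpow_natCast (_ ^ (1 / 2 : ℝ)), ← ENNReal.rpow_mul,
          ← ENNReal.rpow_mul, mul_comm ((5 : ℕ) : ℝ)]
        ring
    _ ≤ ENNReal.ofReal (B.toReal + 1) * l2 u ^ 5 * l2 z := by
        gcongr
        rw [← ENNReal.ofReal_toReal hBtop]
        exact ENNReal.ofReal_le_ofReal (by simp)
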